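/- For any (N_x+1)×(N_y+1) real matrix u, the regular-grid discrete Laplacian satisfies the weighted summation-by-parts identity (Δ̄_h u, u)_Λ = −(∇_h⁺u, ∇_h⁺u)_Λ. -/

import Mathlib

open Matrix

noncomputable section

/-- Forward difference matrix `D⁺` on a grid with `M` points:
`(D⁺)_{j,j} = -1/h`, `(D⁺)_{j,j+1} = 1/h` for the first `M-1` rows, last row zero. -/
def Dplus (M : ℕ) (h : ℝ) : Matrix (Fin M) (Fin M) ℝ :=
  Matrix.of fun j k =>
    if (j : ℕ) + 1 < M then
      if k = j then -1 / h else if (k : ℕ) = (j : ℕ) + 1 then 1 / h else 0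
    else 0

/-- Backward difference matrix `D⁻`: `(D⁻)_{j,j} = 1/h`, `(D⁻)_{j,j-1} = -1/h`
for all rows but the first, first row zero. -/
def Dminus (M : ℕ) (h : ℝ) : Matrix (Fin M) (Fin M) ℝ :=
  Matrix.of fun j k =>
    if 1 ≤ (j : ℕ) then
      if k = j then 1 / h else if (k : ℕ) + 1 = (j : ℕ) then -1 / h else 0
    else 0

/-- Symmetric second-order difference matrix `D²` with Neumann corners:
diagonal `(-1, -2, …, -2, -1)/h²`, off-diagonals `1/h²`. -/
def D2 (M : ℕ) (h : ℝ) : Matrix (Fin M) (Fin M) ℝ :=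
  Matrix.of fun j k =>
    if k = j then (if (j : ℕ) = 0 ∨ (j : ℕ) = M - 1 then -1 / h ^ 2 else -2 / h ^ 2)
    else if (k : ℕ) = (j : ℕ) + 1 ∨ (j : ℕ) = (k : ℕ) + 1 then 1 / h ^ 2
    else 0

/-- SBP weight matrix `Λ = diag(1/2, 1, …, 1, 1/2)`. -/
def Lam (M : ℕ) : Matrix (Fin M) (Fin M) ℝ :=
  Matrix.of fun j k =>
    if k = j then (if (j : ℕ) = 0 ∨ (j : ℕ) = M - 1 then 1 / 2 else 1) else 0

/-- Regular-grid second-order central difference matrix with ghost-point Neumann closure. -/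
def Dbar2 (M : ℕ) (h : ℝ) : Matrix (Fin M) (Fin M) ℝ :=
  Matrix.of fun j k =>
    if (j : ℕ) = 0 then
      if (k : ℕ) = 0 then -2 / h ^ 2 else if (k : ℕ) = 1 then 2 / h ^ 2 else 0
    else if (j : ℕ) = M - 1 then
      if (k : ℕ) = M - 1 then -2 / h ^ 2 else if (k : ℕ) = M - 2 then 2 / h ^ 2 else 0
    else
      if k = j then -2 / h ^ 2
      else if (k : ℕ) = (j : ℕ) + 1 ∨ (j : ℕ) = (k : ℕ) + 1 then 1 / h ^ 2 else 0

/-- Discrete `L²` inner product `(u,v)_h = h_x h_y ∑_{j,k} u_{jk} v_{jk}`. -/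
def iph {m n : ℕ} (hx hy : ℝ) (u v : Matrix (Fin m) (Fin n) ℝ) : ℝ :=
  hx * hy * ∑ j, ∑ k, u j k * v j k

/-- Entrywise `Φ · sin U`. -/
def hadSin {m n : ℕ} (Φ U : Matrix (Fin m) (Fin n) ℝ) : Matrix (Fin m) (Fin n) ℝ :=
  Matrix.of fun j k => Φ j k * Real.sin (U j k)

/-- Entrywise `Φ · (𝟙 - cos U)`. -/
def hadOneSubCos {m n : ℕ} (Φ U : Matrix (Fin m) (Fin n) ℝ) : Matrix (Fin m) (Fin n) ℝ :=
  Matrix.of fun j k => Φ j k * (1 - Real.cos (U j k))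

/-- The all-ones matrix `𝟙`. -/
def oneM (m n : ℕ) : Matrix (Fin m) (Fin n) ℝ := Matrix.of fun _ _ => 1


theorem Dplus_apply_of_lt {N : ℕ} (h : ℝ) {j : ℕ} (hj : j < N) (k : Fin (N + 1)) :
    Dplus (N + 1) h ⟨j, by omega⟩ k =
      (if (k : ℕ) = j + 1 then 1 / h else 0) - (if (k : ℕ) = j then 1 / h else 0) := by
  simp only [Dplus, Matrix.of_apply, Fin.ext_iff]
  split_ifs <;> first | omega | ring

theorem sum_range_ite_eq_succ {N k : ℕ} (hk : k ≤ N) (f : ℕ → ℝ) :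
    ∑ j ∈ Finset.range N, (if k = j + 1 then f j else 0) = if k = 0 then 0 else f (k - 1) := by
  cases k with
  | zero => simp
  | succ k => simp [Nat.lt_of_succ_le hk]

/-- The Neumann second difference factors as `D² = -(D⁺)ᵀ D⁺`. -/
theorem D2_eq_neg_transpose_mul {N : ℕ} (hN : 0 < N) (h : ℝ) :
    D2 (N + 1) h = -((Dplus (N + 1) h)ᵀ * Dplus (N + 1) h) := by
  ext k l
  have hk := k.isLt
  have hl := l.isLt
  let d : ℕ → ℕ → ℝ := fun j m =>
    (if m = j + 1 then 1 / h else 0) - (if m = j then 1 / h else 0)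
  have hsum : ∑ j, Dplus (N + 1) h j k * Dplus (N + 1) h j l =
      ∑ j ∈ Finset.range N, d j k * d j l := by
    rw [Fin.sum_univ_castSucc, Finset.sum_range]
    have hlast : Dplus (N + 1) h (Fin.last N) k = 0 := by simp [Dplus]
    rw [hlast, zero_mul, add_zero]
    exact Finset.sum_congr rfl fun j _ => congrArg₂ (· * ·)
      (Dplus_apply_of_lt h j.isLt k) (Dplus_apply_of_lt h j.isLt l)
  have hsplit : ∑ j ∈ Finset.range N, d j k * d j l =
      (∑ j ∈ Finset.range N, if (k : ℕ) = j + 1 then 1 / h * d j l else 0) -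
        ∑ j ∈ Finset.range N, if (k : ℕ) = j then 1 / h * d j l else 0 := by
    rw [← Finset.sum_sub_distrib]
    refine Finset.sum_congr rfl fun j _ => ?_
    simp only [d, sub_mul, ite_mul, zero_mul]
  simp only [Matrix.neg_apply, Matrix.mul_apply, Matrix.transpose_apply]
  rw [hsum, hsplit, sum_range_ite_eq_succ (Nat.le_of_lt_succ hk) (fun j => 1 / h * d j l),
    Finset.sum_ite_eq]
  simp only [D2, Matrix.of_apply, d, Finset.mem_range, Fin.ext_iff]
  split_ifs <;> first | omega | ring

theorem Lam_mul_inv_and_inv_mul (M : ℕ) : Lam M * (Lam M)⁻¹ = 1 ∧ (Lam M)⁻¹ * Lam M = 1 := by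
  have hdiag : Lam M = Matrix.diagonal fun j : Fin M =>
      if (j : ℕ) = 0 ∨ (j : ℕ) = M - 1 then (1 / 2 : ℝ) else 1 := by
    ext j k
    simp only [Lam, Matrix.of_apply, Matrix.diagonal_apply, eq_comm]
  have hdet : IsUnit (Lam M).det := by
    rw [hdiag, Matrix.det_diagonal, isUnit_iff_ne_zero, Finset.prod_ne_zero_iff]
    intro j _
    split_ifs <;> norm_num
  exact ⟨Matrix.mul_nonsing_inv _ hdet, Matrix.nonsing_inv_mul _ hdet⟩

theorem iph_eq_trace {m n : ℕ} (hx hy : ℝ) (u v : Matrix (Fin m) (Fin n) ℝ) :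
    iph hx hy u v = hx * hy * (uᵀ * v).trace := by
  rw [iph, Finset.sum_comm]
  simp [Matrix.trace, Matrix.mul_apply]

theorem iph_transpose_mul {m n p : ℕ} (hx hy : ℝ) (A : Matrix (Fin p) (Fin m) ℝ)
    (B : Matrix (Fin p) (Fin n) ℝ) (v : Matrix (Fin m) (Fin n) ℝ) :
    iph hx hy (Aᵀ * B) v = iph hx hy B (A * v) := by
  simp only [iph_eq_trace, Matrix.transpose_mul, Matrix.transpose_transpose, Matrix.mul_assoc]

theorem iph_mul {m n p : ℕ} (hx hy : ℝ) (B : Matrix (Fin m) (Fin p) ℝ)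
    (A : Matrix (Fin p) (Fin n) ℝ) (v : Matrix (Fin m) (Fin n) ℝ) :
    iph hx hy (B * A) v = iph hx hy B (v * Aᵀ) := by
  simp only [iph_eq_trace, Matrix.transpose_mul]
  rw [Matrix.mul_assoc, Matrix.trace_mul_comm, Matrix.mul_assoc]

theorem iph_neg_add_neg {m n : ℕ} (hx hy : ℝ) (a b v : Matrix (Fin m) (Fin n) ℝ) :
    iph hx hy (-a + -b) v = -(iph hx hy a v + iph hx hy b v) := by
  simp only [iph_eq_trace, Matrix.transpose_add, Matrix.transpose_neg, Matrix.add_mul,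
    Matrix.neg_mul, Matrix.trace_add, Matrix.trace_neg]
  ring

/-- Weighted summation by parts on the regular grid: `(Δ̄_h u, u)_Λ = -(∇_h⁺ u, ∇_h⁺ u)_Λ`. -/
theorem stmt11 (Nx Ny : ℕ) (hNx : 0 < Nx) (hNy : 0 < Ny)
    (hx hy : ℝ) (hhx : 0 < hx) (hhy : 0 < hy)
    (u : Matrix (Fin (Nx + 1)) (Fin (Ny + 1)) ℝ) :
    iph hx hy (Lam (Nx + 1) *
        ((Lam (Nx + 1))⁻¹ * D2 (Nx + 1) hx * u + u * D2 (Ny + 1) hy * (Lam (Ny + 1))⁻¹) *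
        Lam (Ny + 1)) u =
      -(iph hx hy (Dplus (Nx + 1) hx * u * Lam (Ny + 1)) (Dplus (Nx + 1) hx * u) +
        iph hx hy (Lam (Nx + 1) * (u * (Dplus (Ny + 1) hy)ᵀ)) (u * (Dplus (Ny + 1) hy)ᵀ)) := by
  have hop : Lam (Nx + 1) *
        ((Lam (Nx + 1))⁻¹ * D2 (Nx + 1) hx * u + u * D2 (Ny + 1) hy * (Lam (Ny + 1))⁻¹) *
        Lam (Ny + 1) =
      -((Dplus (Nx + 1) hx)ᵀ * (Dplus (Nx + 1) hx * u * Lam (Ny + 1))) +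
        -(Lam (Nx + 1) * (u * (Dplus (Ny + 1) hy)ᵀ) * Dplus (Ny + 1) hy) := by
    rw [D2_eq_neg_transpose_mul hNx, D2_eq_neg_transpose_mul hNy, Matrix.mul_add, Matrix.add_mul]
    simp only [Matrix.mul_assoc, (Lam_mul_inv_and_inv_mul _).2, Matrix.mul_one]
    rw [← Matrix.mul_assoc (Lam (Nx + 1)) (Lam (Nx + 1))⁻¹, (Lam_mul_inv_and_inv_mul _).1,
      Matrix.one_mul]
    simp only [Matrix.neg_mul, Matrix.mul_neg, Matrix.mul_assoc]
  rw [hop, iph_neg_add_neg, iph_transpose_mul,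
    iph_mul _ _ _ (Dplus (Ny + 1) hy)]

end
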